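/- Fix a real number c, a real number a with a > c_− (where c_− = max(0,−c)), and an integer r ≥ 1. Let A_LCR = { f ∈ D : φ_LCR(f) ≥ a } with φ_LCR(f) = sup_{t∈[0,1]} { f(t) − c t − J_r^t(f) }, let A_LCR^ε = { f ∈ D : d(f, A_LCR) ≤ ε } for ε > 0, and let D_{≤j} be the set of nondecreasing step functions vanishing at the origin with at most j steps. Then there exists ε > 0 such that A_LCR^ε ∩ D_{≤r+1} is bounded away from D_{≤r} in the Skorokhod J1 metric, i.e. inf { d(f,g) : f ∈ A_LCR^ε ∩ D_{≤r+1}, g ∈ D_{≤r} } > 0. In particular, this holds for every ε ≤ (a − c_−)/(2(|c| + 2r + 1)). -/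

import Mathlib

open MeasureTheory Filter Set Polynomial

noncomputable section

/-- Jump of `f` at `s`, with the convention `f(0⁻) = f(0)` (so the jump at `0` is `0`). -/
def jumpAt (f : ℝ → ℝ) (s : ℝ) : ℝ :=
  if s = 0 then 0 else f s - Function.leftLim f s

/-- `J m t f`: supremum over `m`-tuples of pairwise distinct points of `[0,t]` of the
sum of the jumps of `f` at these points (`J m 0 f = 0`). -/
def J (m : ℕ) (t : ℝ) (f : ℝ → ℝ) : ℝ :=
  ⨆ s : { s : Fin m → ℝ // (∀ i, s i ∈ Set.Icc 0 t) ∧ Function.Injective s },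
    ∑ i, jumpAt f (s.val i)

/-- `f` is càdlàg on `[0,1]`: right-continuous, with left limits. -/
def Cadlag (f : ℝ → ℝ) : Prop :=
  (∀ x ∈ Set.Icc (0:ℝ) 1, ContinuousWithinAt f (Set.Ici x) x) ∧
  (∀ x ∈ Set.Ioc (0:ℝ) 1, ∃ l, Filter.Tendsto f (nhdsWithin x (Set.Iio x)) (nhds l))

/-- A strictly increasing continuous bijection of `[0,1]` onto itself. -/
def TimeChange (l : ℝ → ℝ) : Prop :=
  StrictMonoOn l (Set.Icc 0 1) ∧ ContinuousOn l (Set.Icc 0 1) ∧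
    Set.BijOn l (Set.Icc 0 1) (Set.Icc 0 1)

/-- Uniform (sup) norm on `[0,1]`. -/
def supIcc (f : ℝ → ℝ) : ℝ := ⨆ x : Set.Icc (0:ℝ) 1, |f x.val|

/-- The Skorokhod J1 metric on càdlàg functions on `[0,1]`. -/
def skorokhodDist (f g : ℝ → ℝ) : ℝ :=
  ⨅ l : { l : ℝ → ℝ // TimeChange l },
    max (supIcc fun x => l.val x - x) (supIcc fun x => f x - g (l.val x))

/-- The LCR functional `φ_LCR(f) = sup_{t∈[0,1]} { f(t) − c t − J_r^t(f) }`. -/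
def phiLCR (c : ℝ) (r : ℕ) (f : ℝ → ℝ) : ℝ :=
  ⨆ t : Set.Icc (0:ℝ) 1, (f t.val - c * t.val - J r t.val f)

/-- The ECOMOR functional
`φ_EC(f) = sup_{t∈[0,1]} { f(t) − c t − (r+1)·J_r^t(f) + r·J_{r+1}^t(f) }`. -/
def phiEC (c : ℝ) (r : ℕ) (f : ℝ → ℝ) : ℝ :=
  ⨆ t : Set.Icc (0:ℝ) 1,
    (f t.val - c * t.val - ((r:ℝ) + 1) * J r t.val f + (r:ℝ) * J (r+1) t.val f)

/-- The step function `x ↦ ∑ i, y i · 1_{[τ i, 1]}(x)`, viewed as a function on `ℝ`. -/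
def stepFun {k : ℕ} (y τ : Fin k → ℝ) : ℝ → ℝ :=
  fun x => ∑ i, if τ i ≤ x then y i else 0

/-- Nondecreasing step functions vanishing at the origin with at most `j` steps. -/
def stepSet (j : ℕ) : Set (ℝ → ℝ) :=
  { f | ∃ k : ℕ, k ≤ j ∧ ∃ y τ : Fin k → ℝ,
      (∀ i, 0 < y i) ∧ (∀ i, τ i ∈ Set.Ioo (0:ℝ) 1) ∧ Function.Injective τ ∧
      f = stepFun y τ }

/-- Skorokhod distance from a function to a set of functions. -/
def distToSet (f : ℝ → ℝ) (A : Set (ℝ → ℝ)) : ℝ := ⨅ g : A, skorokhodDist f g.val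

/-- The Gauss hypergeometric function `₂F₁(b,e;d;z)`. -/
def hyp2F1 (b e d z : ℝ) : ℝ :=
  ∑' k : ℕ, ((ascPochhammer ℝ k).eval b * (ascPochhammer ℝ k).eval e /
    (ascPochhammer ℝ k).eval d) * z ^ k / (k.factorial : ℝ)

end

/-- The `ε`-fattening (in Skorokhod distance) of `A_LCR = {f ∈ D : φ_LCR(f) ≥ a}`,
intersected with the step functions with at most `r+1` steps, is bounded away from the
step functions with at most `r` steps. -/
def BoundedAwayLCR (c a ε : ℝ) (r : ℕ) : Prop :=
  0 < sInf { d : ℝ | ∃ f,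
      (Cadlag f ∧ distToSet f { h | Cadlag h ∧ a ≤ phiLCR c r h } ≤ ε) ∧
      f ∈ stepSet (r+1) ∧ ∃ g ∈ stepSet r, d = skorokhodDist f g }

theorem Cadlag.exists_bound {f : ℝ → ℝ} (hf : Cadlag f) :
    ∃ M, ∀ x ∈ Set.Icc (0:ℝ) 1, |f x| ≤ M := by
  refine isCompact_Icc.induction_on (p := fun s => ∃ M, ∀ x ∈ s, |f x| ≤ M) ?_ ?_ ?_ ?_
  · exact ⟨0, by simp⟩
  · rintro s t hst ⟨M, hM⟩
    exact ⟨M, fun x hx => hM x (hst hx)⟩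
  · rintro s t ⟨M, hM⟩ ⟨N, hN⟩
    refine ⟨max M N, fun x hx => ?_⟩
    rcases hx with hx | hx
    · exact (hM x hx).trans (le_max_left _ _)
    · exact (hN x hx).trans (le_max_right _ _)
  · intro x hx
    have hR : ∃ M, ∀ᶠ y in nhdsWithin x (Set.Ici x), y ∈ Set.Icc (0:ℝ) 1 → |f y| ≤ M := by
      refine ⟨|f x| + 1, ?_⟩
      filter_upwards [(hf.1 x hx).abs.eventually (gt_mem_nhds (lt_add_one _))] with y hy _
      exact hy.le
    have hL : ∃ M, ∀ᶠ y in nhdsWithin x (Set.Iio x), y ∈ Set.Icc (0:ℝ) 1 → |f y| ≤ M := by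
      rcases hx.1.eq_or_lt with h0 | h0
      · refine ⟨0, ?_⟩
        filter_upwards [self_mem_nhdsWithin] with y hy hy'
        rw [Set.mem_Iio] at hy
        linarith [hy'.1]
      · obtain ⟨l, hl⟩ := hf.2 x ⟨h0, hx.2⟩
        refine ⟨|l| + 1, ?_⟩
        filter_upwards [hl.abs.eventually (gt_mem_nhds (lt_add_one _))] with y hy _
        exact hy.le
    obtain ⟨M, hM⟩ := hR
    obtain ⟨N, hN⟩ := hL
    have h : ∀ᶠ y in nhds x, y ∈ Set.Icc (0:ℝ) 1 → |f y| ≤ max M N := by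
      rw [← nhdsLT_sup_nhdsGE, Filter.eventually_sup]
      exact ⟨hN.mono fun y h hy => (h hy).trans (le_max_right _ _),
        hM.mono fun y h hy => (h hy).trans (le_max_left _ _)⟩
    refine ⟨{y | y ∈ Set.Icc (0:ℝ) 1 → |f y| ≤ max M N} ∩ Set.Icc 0 1, ?_, max M N,
      fun y hy => hy.1 hy.2⟩
    exact Filter.inter_mem (mem_nhdsWithin_of_mem_nhds h) self_mem_nhdsWithin

theorem Cadlag.tendsto_leftLim {f : ℝ → ℝ} (hf : Cadlag f) {x : ℝ} (hx : x ∈ Set.Ioc (0:ℝ) 1) :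
    Tendsto f (nhdsWithin x (Set.Iio x)) (nhds (Function.leftLim f x)) := by
  obtain ⟨l, hl⟩ := hf.2 x hx
  rwa [leftLim_eq_of_tendsto hl]

theorem Cadlag.abs_jumpAt_le {f : ℝ → ℝ} (hf : Cadlag f) {M : ℝ}
    (hM : ∀ x ∈ Set.Icc (0:ℝ) 1, |f x| ≤ M) {x : ℝ} (hx : x ∈ Set.Icc (0:ℝ) 1) :
    |jumpAt f x| ≤ 2 * M := by
  have hM0 : 0 ≤ M := (abs_nonneg _).trans (hM x hx)
  unfold jumpAt
  split_ifs with h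
  · simpa using hM0
  · have hx0 : 0 < x := lt_of_le_of_ne hx.1 (Ne.symm h)
    have h1 : |Function.leftLim f x| ≤ M := by
      refine le_of_tendsto (hf.tendsto_leftLim ⟨hx0, hx.2⟩).abs ?_
      filter_upwards [Ioo_mem_nhdsLT hx0] with y hy
      exact hM y ⟨hy.1.le, hy.2.le.trans hx.2⟩
    have := abs_sub (f x) (Function.leftLim f x)
    linarith [hM x hx]

theorem Cadlag.bddAbove_jump_sums {f : ℝ → ℝ} (hf : Cadlag f) (m : ℕ) {t : ℝ} (ht : t ≤ 1) :
    BddAbove (Set.range fun s : { s : Fin m → ℝ //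
      (∀ i, s i ∈ Set.Icc 0 t) ∧ Function.Injective s } => ∑ i, jumpAt f (s.val i)) := by
  obtain ⟨M, hM⟩ := hf.exists_bound
  refine ⟨m * (2 * M), ?_⟩
  rintro _ ⟨s, rfl⟩
  have : ∑ i, jumpAt f (s.val i) ≤ ∑ _i : Fin m, 2 * M :=
    Finset.sum_le_sum fun i _ => (le_abs_self _).trans
      (hf.abs_jumpAt_le hM ⟨(s.2.1 i).1, (s.2.1 i).2.trans ht⟩)
  simpa using this

/-- Any `m` distinct points of `[0,t]` give a lower bound for `J m t f`. -/
theorem Cadlag.sum_jumpAt_le_J {f : ℝ → ℝ} (hf : Cadlag f) {t : ℝ} (ht : t ≤ 1)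
    {T : Finset ℝ} (hT : ∀ u ∈ T, u ∈ Set.Icc 0 t) :
    ∑ u ∈ T, jumpAt f u ≤ J T.card t f := by
  have h := le_ciSup (hf.bddAbove_jump_sums T.card ht)
    ⟨fun i => (T.equivFin.symm i : ℝ), fun i => hT _ (T.equivFin.symm i).2,
      Subtype.val_injective.comp T.equivFin.symm.injective⟩
  refine le_trans (le_of_eq ?_) h
  rw [← Finset.sum_coe_sort]
  exact (T.equivFin.symm.sum_comp fun u => jumpAt f u).symm

theorem J_zero_nonneg (m : ℕ) (f : ℝ → ℝ) : 0 ≤ J m 0 f := by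
  refine Real.iSup_nonneg fun s => Finset.sum_nonneg fun i _ => ?_
  have : s.val i = 0 := by simpa using s.2.1 i
  simp [jumpAt, this]

theorem TimeChange.mem_Icc {l : ℝ → ℝ} (hl : TimeChange l) {x : ℝ} (hx : x ∈ Set.Icc (0:ℝ) 1) :
    l x ∈ Set.Icc (0:ℝ) 1 := hl.2.2.mapsTo hx

theorem TimeChange.map_zero {l : ℝ → ℝ} (hl : TimeChange l) : l 0 = 0 := by
  obtain ⟨x, hx, h⟩ := hl.2.2.surjOn (show (0:ℝ) ∈ Set.Icc (0:ℝ) 1 by simp)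
  have h0 : (0:ℝ) ∈ Set.Icc (0:ℝ) 1 := by simp
  exact le_antisymm (h ▸ hl.1.monotoneOn h0 hx hx.1) (hl.mem_Icc h0).1

theorem TimeChange.pos {l : ℝ → ℝ} (hl : TimeChange l) {x : ℝ} (hx : x ∈ Set.Ioc (0:ℝ) 1) :
    0 < l x := by
  have := hl.1 (show (0:ℝ) ∈ Set.Icc (0:ℝ) 1 by simp) ⟨hx.1.le, hx.2⟩ hx.1
  rwa [hl.map_zero] at this

theorem timeChange_id : TimeChange id :=
  ⟨strictMonoOn_id, continuousOn_id, Set.bijOn_id _⟩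

theorem TimeChange.tendsto_nhdsLT {l : ℝ → ℝ} (hl : TimeChange l) {x : ℝ}
    (hx : x ∈ Set.Ioc (0:ℝ) 1) :
    Tendsto l (nhdsWithin x (Set.Iio x)) (nhdsWithin (l x) (Set.Iio (l x))) := by
  have hx' : x ∈ Set.Icc (0:ℝ) 1 := ⟨hx.1.le, hx.2⟩
  have hI : ∀ᶠ y in nhdsWithin x (Set.Iio x), y ∈ Set.Icc (0:ℝ) 1 ∧ y < x := by
    filter_upwards [Ioo_mem_nhdsLT hx.1] with y hy
    exact ⟨⟨hy.1.le, hy.2.le.trans hx.2⟩, hy.2⟩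
  refine tendsto_nhdsWithin_iff.2 ⟨?_, hI.mono fun y hy => hl.1 hy.1 hx' hy.2⟩
  refine (hl.2.1 x hx').mono_left ?_
  rw [nhdsWithin]
  exact le_inf (nhdsWithin_le_nhds) (le_principal_iff.2 (hI.mono fun y hy => hy.1))

theorem jumpAt_le_jumpAt_timeChange {f g l : ℝ → ℝ} (hf : Cadlag f) (hg : Cadlag g)
    (hl : TimeChange l) {e : ℝ} (he : ∀ x ∈ Set.Icc (0:ℝ) 1, |f x - g (l x)| ≤ e)
    {x : ℝ} (hx : x ∈ Set.Ioc (0:ℝ) 1) :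
    jumpAt f x ≤ jumpAt g (l x) + 2 * e := by
  have hlx := hl.pos hx
  have hx' : x ∈ Set.Icc (0:ℝ) 1 := ⟨hx.1.le, hx.2⟩
  have hlim := (hf.tendsto_leftLim hx).sub
    ((hg.tendsto_leftLim ⟨hlx, (hl.mem_Icc hx').2⟩).comp (hl.tendsto_nhdsLT hx))
  have h1 : |Function.leftLim f x - Function.leftLim g (l x)| ≤ e := by
    refine le_of_tendsto hlim.abs ?_
    filter_upwards [Ioo_mem_nhdsLT hx.1] with y hy
    exact he y ⟨hy.1.le, hy.2.le.trans hx.2⟩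
  have h2 := he x hx'
  rw [abs_le] at h1 h2
  simp only [jumpAt, hx.1.ne', hlx.ne', if_false]
  linarith [h1.1, h2.2]

theorem abs_le_supIcc {f : ℝ → ℝ} {M : ℝ} (hM : ∀ x ∈ Set.Icc (0:ℝ) 1, |f x| ≤ M) {x : ℝ}
    (hx : x ∈ Set.Icc (0:ℝ) 1) : |f x| ≤ supIcc f :=
  le_ciSup (f := fun x : Set.Icc (0:ℝ) 1 => |f x.val|)
    ⟨M, by rintro _ ⟨y, rfl⟩; exact hM y y.2⟩ ⟨x, hx⟩

theorem supIcc_nonneg (f : ℝ → ℝ) : 0 ≤ supIcc f := Real.iSup_nonneg fun _ => abs_nonneg _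

theorem bddBelow_skorokhod (f g : ℝ → ℝ) :
    BddBelow (Set.range fun l : { l : ℝ → ℝ // TimeChange l } =>
      max (supIcc fun x => l.val x - x) (supIcc fun x => f x - g (l.val x))) :=
  ⟨0, by rintro _ ⟨l, rfl⟩; exact le_max_of_le_left (supIcc_nonneg _)⟩

theorem skorokhodDist_nonneg (f g : ℝ → ℝ) : 0 ≤ skorokhodDist f g :=
  Real.iInf_nonneg fun _ => le_max_of_le_left (supIcc_nonneg _)

theorem skorokhodDist_self (f : ℝ → ℝ) : skorokhodDist f f = 0 := by
  refine le_antisymm ?_ (skorokhodDist_nonneg f f)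
  refine (ciInf_le (bddBelow_skorokhod f f) ⟨id, timeChange_id⟩).trans ?_
  simp [supIcc]

theorem exists_timeChange_of_skorokhodDist_lt {f g : ℝ → ℝ} (hf : Cadlag f) (hg : Cadlag g)
    {e : ℝ} (h : skorokhodDist f g < e) :
    ∃ l, TimeChange l ∧ (∀ x ∈ Set.Icc (0:ℝ) 1, |l x - x| ≤ e) ∧
      ∀ x ∈ Set.Icc (0:ℝ) 1, |f x - g (l x)| ≤ e := by
  have : Nonempty { l : ℝ → ℝ // TimeChange l } := ⟨⟨id, timeChange_id⟩⟩
  obtain ⟨⟨l, hl⟩, hlt⟩ := exists_lt_of_ciInf_lt h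
  obtain ⟨M, hM⟩ := hf.exists_bound
  obtain ⟨N, hN⟩ := hg.exists_bound
  rw [max_lt_iff] at hlt
  refine ⟨l, hl, fun x hx => ?_, fun x hx => ?_⟩
  · refine (abs_le_supIcc (f := fun x => l x - x) (M := 1) (fun y hy => ?_) hx).trans hlt.1.le
    have := hl.mem_Icc hy
    rw [abs_le]
    constructor <;> linarith [this.1, this.2, hy.1, hy.2]
  · refine (abs_le_supIcc (f := fun x => f x - g (l x)) (M := M + N) (fun y hy => ?_) hx).trans
      hlt.2.le
    exact (abs_sub _ _).trans (add_le_add (hM y hy) (hN _ (hl.mem_Icc hy)))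

theorem tendsto_stepFun_nhdsLT {k : ℕ} (y τ : Fin k → ℝ) (x : ℝ) :
    Tendsto (stepFun y τ) (nhdsWithin x (Set.Iio x))
      (nhds (∑ i, if τ i < x then y i else 0)) := by
  refine tendsto_finsetSum _ fun i _ => tendsto_const_nhds.congr' ?_
  by_cases h : τ i < x
  · filter_upwards [Ioo_mem_nhdsLT h] with z hz
    simp [h, hz.1.le]
  · filter_upwards [self_mem_nhdsWithin] with z hz
    have : ¬ τ i ≤ z := fun h' => h (h'.trans_lt hz)
    simp [h, this]

theorem cadlag_stepFun {k : ℕ} (y τ : Fin k → ℝ) : Cadlag (stepFun y τ) := by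
  refine ⟨fun x _ => ?_, fun x _ => ⟨_, tendsto_stepFun_nhdsLT y τ x⟩⟩
  refine tendsto_finsetSum _ fun i _ => tendsto_const_nhds.congr' ?_
  by_cases h : τ i ≤ x
  · filter_upwards [self_mem_nhdsWithin] with z hz
    have : τ i ≤ z := h.trans hz
    simp [h, this]
  · filter_upwards [mem_nhdsWithin_of_mem_nhds (Iio_mem_nhds (not_le.1 h))] with z hz
    have : ¬ τ i ≤ z := not_le.2 hz
    simp [h, this]

theorem jumpAt_stepFun {k : ℕ} (y τ : Fin k → ℝ) {x : ℝ} (hx : x ≠ 0) :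
    jumpAt (stepFun y τ) x = ∑ i, if τ i = x then y i else 0 := by
  rw [jumpAt, if_neg hx, leftLim_eq_of_tendsto (tendsto_stepFun_nhdsLT y τ x),
    stepFun, ← Finset.sum_sub_distrib]
  refine Finset.sum_congr rfl fun i _ => ?_
  rcases lt_trichotomy (τ i) x with h | h | h
  · simp [h, h.le, h.ne]
  · simp [h]
  · simp [h.not_gt, h.not_ge, h.ne']

theorem jumpAt_stepFun_apply {k : ℕ} (y : Fin k → ℝ) {τ : Fin k → ℝ} (hτ : Function.Injective τ)
    {j : Fin k} (hj : τ j ≠ 0) : jumpAt (stepFun y τ) (τ j) = y j := by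
  simp [jumpAt_stepFun y τ hj, hτ.eq_iff]

theorem jumpAt_stepFun_nonneg {k : ℕ} {y : Fin k → ℝ} (hy : ∀ i, 0 < y i) (τ : Fin k → ℝ)
    (x : ℝ) : 0 ≤ jumpAt (stepFun y τ) x := by
  by_cases hx : x = 0
  · simp [jumpAt, hx]
  · rw [jumpAt_stepFun y τ hx]
    refine Finset.sum_nonneg fun i _ => ?_
    split_ifs
    exacts [(hy i).le, le_rfl]

theorem exists_mem_stepSet_le_phiLCR (c a : ℝ) (r : ℕ) :
    ∃ f ∈ stepSet (r + 1), Cadlag f ∧ a ≤ phiLCR c r f := by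
  set Y : ℝ := |a| + |c| + 1 with hY
  have hYpos : 0 < Y := by positivity
  set τ : Fin (r + 1) → ℝ := fun i => ((i : ℝ) + 1) / (r + 2) with hτ
  have hr : (0:ℝ) < r + 2 := by positivity
  have hτm : ∀ i, τ i ∈ Set.Ioo (0:ℝ) 1 := by
    intro i
    have : (i : ℝ) + 1 ≤ r + 1 := by exact_mod_cast i.2
    refine ⟨by simp only [hτ]; positivity, ?_⟩
    simp only [hτ]
    rw [div_lt_one hr]
    linarith
  have hτi : Function.Injective τ := by
    intro i j h
    simp only [hτ] at h
    rw [div_left_inj' hr.ne'] at h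
    exact Fin.ext (by exact_mod_cast add_right_cancel h)
  set f := stepFun (fun _ => Y) τ with hf
  have hjump : ∀ x, 0 ≤ jumpAt f x := jumpAt_stepFun_nonneg (fun _ => hYpos) τ
  have hjumpY : ∀ x, jumpAt f x ≤ Y := by
    intro x
    by_cases hx : ∃ j, τ j = x
    · obtain ⟨j, rfl⟩ := hx
      exact (jumpAt_stepFun_apply _ hτi (hτm j).1.ne').le
    · push Not at hx
      by_cases h0 : x = 0
      · simpa [jumpAt, h0] using hYpos.le
      · rw [hf, jumpAt_stepFun _ _ h0]
        simpa [hx] using hYpos.le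
  refine ⟨f, ⟨r + 1, le_rfl, _, τ, fun _ => hYpos, hτm, hτi, rfl⟩, cadlag_stepFun _ _, ?_⟩
  have hbdd : BddAbove (Set.range fun t : Set.Icc (0:ℝ) 1 =>
      f t.val - c * t.val - J r t.val f) := by
    obtain ⟨M, hM⟩ := (cadlag_stepFun (fun _ => Y) τ).exists_bound
    refine ⟨M + |c|, ?_⟩
    rintro _ ⟨t, rfl⟩
    have h1 := (le_abs_self _).trans (hM t t.2)
    have h2 : 0 ≤ J r t.val f := Real.iSup_nonneg fun s => Finset.sum_nonneg fun i _ => hjump _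
    have h3 : -(c * t.val) ≤ |c| := by
      refine (neg_le_abs _).trans ?_
      rw [abs_mul, abs_of_nonneg t.2.1]
      exact mul_le_of_le_one_right (abs_nonneg _) t.2.2
    simp only
    linarith
  refine le_trans ?_ (le_ciSup hbdd ⟨1, by simp⟩)
  have hJ : J r 1 f ≤ r * Y := by
    refine Real.iSup_le (fun s => ?_) (by positivity)
    have := Finset.sum_le_sum fun i (_ : i ∈ Finset.univ) => hjumpY (s.val i)
    simpa using this
  have hf1 : f 1 = (r + 1) * Y := by
    simp [hf, stepFun, (hτm _).2.le]
  simp only [hf1]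
  linarith [le_abs_self a, le_abs_self c]

theorem sum_steps_le_J_timeChange {k r : ℕ} {y τ : Fin k → ℝ} (hy : ∀ i, 0 < y i)
    (hτ : ∀ i, 0 < τ i) (hτi : Function.Injective τ) {h l : ℝ → ℝ} (hh : Cadlag h)
    (hl : TimeChange l) {e : ℝ} (he : ∀ x ∈ Set.Icc (0:ℝ) 1, |stepFun y τ x - h (l x)| ≤ e)
    {s : ℝ} (hs : s ∈ Set.Ioc (0:ℝ) 1) {I : Finset (Fin k)} (hI : I.card ≤ r)
    (hIs : ∀ i ∈ I, τ i ≤ s) :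
    ∑ i ∈ I, y i ≤ J r (l s) h + 2 * r * e := by
  obtain ⟨R, hRs, hRr⟩ := (Set.Ioc_infinite hs.1).exists_subset_card_eq r
  obtain ⟨T, hIT, hTU, hTr⟩ := Finset.exists_subsuperset_card_eq
    (Finset.subset_union_left (s₁ := I.image τ) (s₂ := R)) (Finset.card_image_le.trans hI)
    (hRr.ge.trans (Finset.card_le_card Finset.subset_union_right))
  have hTs : ∀ {u}, u ∈ T → u ∈ Set.Ioc 0 s := by
    intro u hu
    rcases Finset.mem_union.1 (hTU hu) with hu | hu
    · obtain ⟨i, hi, rfl⟩ := Finset.mem_image.1 hu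
      exact ⟨hτ i, hIs i hi⟩
    · exact hRs hu
  have hT : ∀ u ∈ T, u ∈ Set.Ioc (0:ℝ) 1 := fun u hu =>
    ⟨(hTs hu).1, (hTs hu).2.trans hs.2⟩
  have hs' : s ∈ Set.Icc (0:ℝ) 1 := ⟨hs.1.le, hs.2⟩
  have hinj : Set.InjOn l T :=
    hl.1.injOn.mono fun u hu => Set.Ioc_subset_Icc_self (hT u hu)
  have hJ := hh.sum_jumpAt_le_J (T := T.image l) (t := l s) (hl.mem_Icc hs').2 (by
    intro v hv
    obtain ⟨u, hu, rfl⟩ := Finset.mem_image.1 hv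
    have hu' : u ∈ Set.Icc (0:ℝ) 1 := ⟨(hT u hu).1.le, (hT u hu).2⟩
    exact ⟨(hl.mem_Icc hu').1, hl.1.monotoneOn hu' hs' (hTs hu).2⟩)
  rw [Finset.card_image_of_injOn hinj, hTr, Finset.sum_image hinj] at hJ
  calc ∑ i ∈ I, y i = ∑ u ∈ I.image τ, jumpAt (stepFun y τ) u := by
        rw [Finset.sum_image hτi.injOn]
        exact Finset.sum_congr rfl fun i _ => (jumpAt_stepFun_apply y hτi (hτ i).ne').symm
    _ ≤ ∑ u ∈ T, jumpAt (stepFun y τ) u :=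
        Finset.sum_le_sum_of_subset_of_nonneg hIT fun u _ _ => jumpAt_stepFun_nonneg hy τ u
    _ ≤ ∑ u ∈ T, (jumpAt h (l u) + 2 * e) := Finset.sum_le_sum fun u hu =>
        jumpAt_le_jumpAt_timeChange (cadlag_stepFun y τ) hh hl he (hT u hu)
    _ ≤ J r (l s) h + 2 * r * e := by
        rw [Finset.sum_add_distrib, Finset.sum_const, hTr, nsmul_eq_mul]
        linarith

/-- A step function with at most `r + 1` steps whose value at `s` exceeds `J r (l s) h` by a
margin has exactly `r + 1` steps, all larger than that margin. -/
theorem steps_gt_of_margin {k r : ℕ} (hk : k ≤ r + 1) {y τ : Fin k → ℝ} (hy : ∀ i, 0 < y i)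
    (hτ : ∀ i, 0 < τ i) (hτi : Function.Injective τ) {h l : ℝ → ℝ} (hh : Cadlag h)
    (hl : TimeChange l) {e : ℝ} (he : ∀ x ∈ Set.Icc (0:ℝ) 1, |stepFun y τ x - h (l x)| ≤ e)
    {s : ℝ} (hs : s ∈ Set.Icc (0:ℝ) 1) {q : ℝ} (hq : 0 ≤ q)
    (hm : J r (l s) h + 2 * r * e + q < stepFun y τ s) :
    k = r + 1 ∧ ∀ j, q < y j := by
  have he0 : 0 ≤ e := (abs_nonneg _).trans (he s hs)
  have hre : 0 ≤ 2 * r * e := by positivity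
  have hs0 : 0 < s := by
    refine lt_of_le_of_ne hs.1 fun h0 => ?_
    have h1 : stepFun y τ 0 = 0 := by simp [stepFun, (hτ _).not_ge]
    rw [← h0, hl.map_zero, h1] at hm
    linarith [J_zero_nonneg r h]
  have key := fun (I : Finset (Fin k)) (hI : I.card ≤ r) (hIs : ∀ i ∈ I, τ i ≤ s) =>
    sum_steps_le_J_timeChange hy hτ hτi hh hl he ⟨hs0, hs.2⟩ hI hIs
  have hsum : stepFun y τ s = ∑ i ∈ Finset.univ.filter (fun i => τ i ≤ s), y i := by
    rw [Finset.sum_filter, stepFun]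
  have hcard : r < (Finset.univ.filter (fun i => τ i ≤ s)).card := by
    by_contra! hle
    have := key _ hle (by simp)
    linarith
  have hle : (Finset.univ.filter (fun i => τ i ≤ s)).card ≤ k := by
    simpa using Finset.card_filter_le (Finset.univ : Finset (Fin k)) (fun i => τ i ≤ s)
  have hkr : k = r + 1 := by omega
  refine ⟨hkr, fun j => ?_⟩
  have huniv : Finset.univ.filter (fun i => τ i ≤ s) = Finset.univ :=
    Finset.eq_univ_of_card _ (by rw [Fintype.card_fin]; omega)
  have hall : ∀ i, τ i ≤ s := by simpa [Finset.filter_eq_self] using huniv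
  have := key (Finset.univ.erase j) (by simp; omega) fun i _ => hall i
  rw [huniv, ← Finset.add_sum_erase _ _ (Finset.mem_univ j)] at hsum
  linarith

theorem le_skorokhodDist_of_steps_gt {r : ℕ} {y τ : Fin (r + 1) → ℝ}
    (hτ : ∀ i, τ i ∈ Set.Ioo (0:ℝ) 1) (hτi : Function.Injective τ) {q : ℝ}
    (hq : ∀ j, 2 * q < y j) {g : ℝ → ℝ} (hg : g ∈ stepSet r) :
    q ≤ skorokhodDist (stepFun y τ) g := by
  obtain ⟨m, hm, z, σ, -, -, -, rfl⟩ := hg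
  by_contra! hlt
  obtain ⟨l, hl, -, he⟩ := exists_timeChange_of_skorokhodDist_lt (cadlag_stepFun y τ)
    (cadlag_stepFun z σ) hlt
  have hτ' : ∀ i, τ i ∈ Set.Ioc (0:ℝ) 1 := fun i => ⟨(hτ i).1, (hτ i).2.le⟩
  have hex : ∀ j, ∃ i, σ i = l (τ j) := by
    intro j
    by_contra! hne
    have := jumpAt_le_jumpAt_timeChange (cadlag_stepFun y τ) (cadlag_stepFun z σ) hl he (hτ' j)
    rw [jumpAt_stepFun_apply y hτi (hτ j).1.ne', jumpAt_stepFun z σ (hl.pos (hτ' j)).ne'] at this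
    simp only [hne, if_false, Finset.sum_const_zero] at this
    linarith [hq j]
  choose p hp using hex
  have hpi : Function.Injective p := fun i j hij => hτi <|
    hl.1.injOn ⟨(hτ i).1.le, (hτ i).2.le⟩ ⟨(hτ j).1.le, (hτ j).2.le⟩ (by
      rw [← hp, ← hp, hij])
  have := Fintype.card_le_of_injective p hpi
  simp only [Fintype.card_fin] at this
  omega

theorem boundedAwayLCR_of_le {c a ε : ℝ} {r : ℕ} (ha : max 0 (-c) < a) (hε : 0 < ε)
    (hle : ε ≤ (a - max 0 (-c)) / (2 * (|c| + 2 * (r:ℝ) + 1))) : BoundedAwayLCR c a ε r := by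
  set η := a - max 0 (-c) with hη
  have hη0 : 0 < η := by linarith
  set D := |c| + 2 * (r:ℝ) + 1 with hD
  have hD0 : 0 < D := by positivity
  have hεD : ε * D ≤ η / 2 := by
    rw [le_div_iff₀ (by positivity)] at hle
    linarith
  have ha0 : 0 < a := (le_max_left _ _).trans_lt ha
  obtain ⟨f₀, hf₀s, hf₀c, hf₀a⟩ := exists_mem_stepSet_le_phiLCR c a r
  unfold BoundedAwayLCR
  refine lt_of_lt_of_le (show 0 < η / 8 by positivity) (le_csInf ?_ ?_)
  · refine ⟨_, f₀, ⟨hf₀c, ?_⟩, hf₀s, fun _ => 0, ⟨0, Nat.zero_le _, ![], ![], ?_⟩, rfl⟩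
    · refine (ciInf_le ⟨0, ?_⟩ ⟨f₀, hf₀c, hf₀a⟩).trans ?_
      · rintro _ ⟨g, rfl⟩
        exact skorokhodDist_nonneg _ _
      · rw [skorokhodDist_self]
        exact hε.le
    · refine ⟨fun i => i.elim0, fun i => i.elim0, fun i => i.elim0, ?_⟩
      funext x
      simp [stepFun]
  rintro _ ⟨f, ⟨-, hdist⟩, ⟨k, hk, y, τ, hy, hτ, hτi, rfl⟩, g, hg, rfl⟩
  set δ := η / (4 * (D + 1)) with hδ
  have hδ0 : 0 < δ := by positivity
  have hδD : δ * (D + 1) = η / 4 := by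
    rw [hδ]
    field_simp
  have : Nonempty { h | Cadlag h ∧ a ≤ phiLCR c r h } := ⟨⟨f₀, hf₀c, hf₀a⟩⟩
  obtain ⟨⟨h, hh, hha⟩, hlt⟩ := exists_lt_of_ciInf_lt (hdist.trans_lt (lt_add_of_pos_right ε hδ0))
  obtain ⟨l, hl, hlid, he⟩ := exists_timeChange_of_skorokhodDist_lt (cadlag_stepFun y τ) hh hlt
  obtain ⟨⟨t, ht⟩, htlt⟩ := exists_lt_of_lt_ciSup ((sub_lt_self a hδ0).trans_le hha)
  obtain ⟨s, hs, rfl⟩ := hl.2.2.surjOn ht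
  have hval := (abs_le.1 (he s hs)).1
  have hcs : -max 0 (-c) ≤ c * s := by
    rcases le_total 0 c with hc | hc
    · exact (neg_nonpos.2 (le_max_left _ _)).trans (mul_nonneg hc hs.1)
    · rw [max_eq_right (by linarith)]
      nlinarith [hs.2]
  have hct : -(|c| * (ε + δ)) ≤ c * (l s - s) := by
    have h1 : |c * (l s - s)| ≤ |c| * (ε + δ) := by
      rw [abs_mul]
      exact mul_le_mul_of_nonneg_left (hlid s hs) (abs_nonneg _)
    exact (abs_le.1 h1).1
  have hDe : D * (ε + δ) = |c| * (ε + δ) + 2 * r * (ε + δ) + (ε + δ) := by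
    rw [hD]
    ring
  have hmargin : J r (l s) h + 2 * r * (ε + δ) + η / 4 < stepFun y τ s := by
    simp only at htlt
    nlinarith
  obtain ⟨rfl, hyq⟩ := steps_gt_of_margin hk hy (fun i => (hτ i).1) hτi hh hl he hs
    (by positivity) hmargin
  exact le_skorokhodDist_of_steps_gt hτ hτi (fun j => by linarith [hyq j]) hg

/-- there is `ε > 0` such that `A_LCR^ε ∩ D_{≤r+1}` is bounded away from
`D_{≤r}`; in particular this holds for every `0 < ε ≤ (a − c₋)/(2(|c| + 2r + 1))`. -/
theorem bounded_away_LCR (c a : ℝ) (r : ℕ) (hr : 1 ≤ r) (ha : max 0 (-c) < a) :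
    (∃ ε : ℝ, 0 < ε ∧ BoundedAwayLCR c a ε r) ∧
    ∀ ε : ℝ, 0 < ε → ε ≤ (a - max 0 (-c)) / (2 * (|c| + 2 * (r:ℝ) + 1)) →
      BoundedAwayLCR c a ε r := by
  refine ⟨⟨(a - max 0 (-c)) / (2 * (|c| + 2 * (r:ℝ) + 1)), ?_, ?_⟩,
    fun ε hε hle => boundedAwayLCR_of_le ha hε hle⟩
  · exact div_pos (sub_pos.2 ha) (by positivity)
  · exact boundedAwayLCR_of_le ha (div_pos (sub_pos.2 ha) (by positivity)) le_rfl
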